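/- Let 1 ≤ r < s ≤ ∞. Then for every real-linear map T on the real vector space H_n of n×n complex Hermitian matrices, ‖T‖_{r→s} ≤ 2√2 · ‖T‖_{∞→∞}^{1−1/r} · ‖T‖_{1→s/r}^{1/r}, with the conventions 1/∞ = 0 and s/r = ∞ when s = ∞. -/

import Mathlib

open scoped ENNReal

/-- The spectral `p`-norm of a Hermitian matrix: the `p`-norm of its eigenvalue vector.
(Junk value `0` for non-Hermitian matrices.) -/
noncomputable def specPNorm {n : ℕ} (p : ℝ≥0∞) (A : Matrix (Fin n) (Fin n) ℂ) : ℝ :=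
  if hA : A.IsHermitian then
    (if p = ∞ then ⨆ i, |hA.eigenvalues i|
     else (∑ i, |hA.eigenvalues i| ^ p.toReal) ^ (1 / p.toReal))
  else 0

/-- The operator norm of a real-linear map on Hermitian matrices (represented as a real-linear
map on all matrices), from the spectral `r`-norm to the spectral `s`-norm: the supremum of
`‖T A‖_s / ‖A‖_r` over nonzero Hermitian `A`. -/
noncomputable def hermOpNorm {n : ℕ} (r s : ℝ≥0∞)
    (T : Matrix (Fin n) (Fin n) ℂ →ₗ[ℝ] Matrix (Fin n) (Fin n) ℂ) : ℝ :=
  ⨆ A : {A : Matrix (Fin n) (Fin n) ℂ // A.IsHermitian ∧ A ≠ 0},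
    specPNorm s (T A.1) / specPNorm r A.1

open Matrix in
/-- The real quadratic form of a matrix at a vector. -/
noncomputable def quadRe {n : ℕ} (H : Matrix (Fin n) (Fin n) ℂ) (f : EuclideanSpace ℂ (Fin n)) :
    ℝ :=
  (star f.ofLp ⬝ᵥ H *ᵥ f.ofLp).re

/-- The rank-one matrix `u uᴴ`. -/
noncomputable def rankOneProj {n : ℕ} (u : EuclideanSpace ℂ (Fin n)) :
    Matrix (Fin n) (Fin n) ℂ :=
  Matrix.vecMulVec u.ofLp (star u.ofLp)

section

variable {n : ℕ}

lemma quadRe_sum_smul (ε : Fin n → ℝ) (H : Fin n → Matrix (Fin n) (Fin n) ℂ)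
    (f : EuclideanSpace ℂ (Fin n)) :
    quadRe (∑ i, ε i • H i) f = ∑ i, ε i * quadRe (H i) f := by
  simp only [quadRe, Matrix.sum_mulVec, Matrix.smul_mulVec, dotProduct_sum, dotProduct_smul,
    Complex.re_sum, Complex.smul_re, smul_eq_mul]

lemma quadRe_rankOneProj (u f : EuclideanSpace ℂ (Fin n)) :
    quadRe (rankOneProj u) f = ‖inner ℂ u f‖ ^ 2 := by
  have h1 : star u.ofLp ⬝ᵥ f.ofLp = inner ℂ u f := by
    rw [EuclideanSpace.inner_eq_star_dotProduct, dotProduct_comm]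
  have h2 : star f.ofLp ⬝ᵥ u.ofLp = star (inner ℂ u f) := by
    rw [← h1, Matrix.star_dotProduct, dotProduct_comm]
  rw [quadRe, rankOneProj, Matrix.vecMulVec_mulVec, dotProduct_smul, h1, h2]
  generalize (inner ℂ u f : ℂ) = z
  simp [← Complex.normSq_eq_norm_sq, Complex.normSq_apply]

lemma isHermitian_rankOneProj (u : EuclideanSpace ℂ (Fin n)) : (rankOneProj u).IsHermitian := by
  rw [rankOneProj, Matrix.IsHermitian, Matrix.conjTranspose_vecMulVec, star_star]

lemma isHermitian_sum_smul_rankOneProj (u : Fin n → EuclideanSpace ℂ (Fin n)) (ε : Fin n → ℝ) :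
    (∑ i, ε i • rankOneProj (u i)).IsHermitian := by
  rw [Matrix.IsHermitian, Matrix.conjTranspose_sum]
  refine Finset.sum_congr rfl fun i _ => ?_
  rw [Matrix.conjTranspose_smul, (isHermitian_rankOneProj (u i)).eq, star_trivial]

lemma Matrix.IsHermitian.eq_sum_eigenvalues_smul_rankOneProj {A : Matrix (Fin n) (Fin n) ℂ}
    (hA : A.IsHermitian) :
    A = ∑ i, hA.eigenvalues i • rankOneProj (hA.eigenvectorBasis i) := by
  conv_lhs => rw [hA.spectral_theorem, Unitary.conjStarAlgAut_apply]
  ext k l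
  rw [Matrix.mul_apply, Matrix.sum_apply]
  refine Finset.sum_congr rfl fun i _ => ?_
  simp only [Matrix.mul_diagonal, Matrix.smul_apply, rankOneProj, Matrix.vecMulVec_apply,
    Matrix.star_apply, Pi.star_apply, Matrix.IsHermitian.eigenvectorUnitary_apply,
    Function.comp_apply, Complex.real_smul, Complex.coe_algebraMap]
  ring

lemma Matrix.IsHermitian.eigenvalues_eq_quadRe {A : Matrix (Fin n) (Fin n) ℂ}
    (hA : A.IsHermitian) (i : Fin n) :
    hA.eigenvalues i = quadRe A (hA.eigenvectorBasis i) :=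
  hA.eigenvalues_eq i

lemma specPNorm_eq_norm {p : ℝ≥0∞} (hp : p ≠ 0) {A : Matrix (Fin n) (Fin n) ℂ}
    (hA : A.IsHermitian) : specPNorm p A = ‖WithLp.toLp p hA.eigenvalues‖ := by
  rw [specPNorm, dif_pos hA]
  split_ifs with h
  · subst h
    rw [PiLp.norm_eq_ciSup]
    rfl
  · rw [PiLp.norm_eq_sum (ENNReal.toReal_pos hp h)]
    rfl

/-- Monotonicity of the `p`-norm with respect to absolute values of the entries. -/
lemma norm_toLp_mono {p : ℝ≥0∞} (hp : p ≠ 0) {a b : Fin n → ℝ} (h : ∀ i, |a i| ≤ |b i|) :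
    ‖WithLp.toLp p a‖ ≤ ‖WithLp.toLp p b‖ := by
  by_cases hpt : p = ∞
  · subst hpt
    rw [PiLp.norm_eq_ciSup, PiLp.norm_eq_ciSup]
    exact ciSup_mono (Set.finite_range _).bddAbove h
  · have hp' := ENNReal.toReal_pos hp hpt
    rw [PiLp.norm_eq_sum hp', PiLp.norm_eq_sum hp']
    refine Real.rpow_le_rpow (by positivity) (Finset.sum_le_sum fun i _ => ?_) (by positivity)
    exact Real.rpow_le_rpow (norm_nonneg _) (h i) hp'.le

/-- A doubly stochastic matrix is a contraction for every `p`-norm, `p ≥ 1`. -/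
lemma norm_toLp_doublyStochastic_le {p : ℝ≥0∞} (hp : 1 ≤ p) (c : Fin n → Fin n → ℝ)
    (hc : ∀ i k, 0 ≤ c i k) (hrow : ∀ i, ∑ k, c i k = 1) (hcol : ∀ k, ∑ i, c i k = 1)
    (ε : Fin n → ℝ) :
    ‖WithLp.toLp p fun k => ∑ i, ε i * c i k‖ ≤ ‖WithLp.toLp p ε‖ := by
  have habs : ∀ k, |∑ i, ε i * c i k| ≤ ∑ i, c i k * |ε i| := fun k => by
    refine (Finset.abs_sum_le_sum_abs _ _).trans (Finset.sum_le_sum fun i _ => ?_)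
    rw [abs_mul, abs_of_nonneg (hc i k), mul_comm]
  by_cases hpt : p = ∞
  · subst hpt
    rw [PiLp.norm_eq_ciSup]
    refine Real.iSup_le (fun k => (habs k).trans ?_) (norm_nonneg _)
    calc ∑ i, c i k * |ε i| ≤ ∑ i, c i k * ‖WithLp.toLp ∞ ε‖ :=
          Finset.sum_le_sum fun i _ => mul_le_mul_of_nonneg_left
            (PiLp.norm_apply_le (WithLp.toLp ∞ ε) i) (hc i k)
      _ = ‖WithLp.toLp ∞ ε‖ := by rw [← Finset.sum_mul, hcol, one_mul]
  · have hp1 : 1 ≤ p.toReal := by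
      rwa [← ENNReal.toReal_one, ENNReal.toReal_le_toReal ENNReal.one_ne_top hpt]
    have hp' : 0 < p.toReal := by linarith
    rw [PiLp.norm_eq_sum hp', PiLp.norm_eq_sum hp']
    refine Real.rpow_le_rpow (by positivity) ?_ (by positivity)
    calc ∑ k, |∑ i, ε i * c i k| ^ p.toReal ≤ ∑ k, ∑ i, c i k * |ε i| ^ p.toReal :=
          Finset.sum_le_sum fun k _ =>
            (Real.rpow_le_rpow (abs_nonneg _) (habs k) hp'.le).trans
              (Real.rpow_arith_mean_le_arith_mean_rpow _ _ _ (fun i _ => hc i k) (hcol k)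
                (fun i _ => abs_nonneg _) hp1)
      _ = ∑ i, |ε i| ^ p.toReal := by
          rw [Finset.sum_comm]
          simp_rw [← Finset.sum_mul, hrow, one_mul]

/-- The diagonal of `∑ εᵢ uᵢ uᵢᴴ` in any orthonormal basis has `p`-norm at most that of `ε`. -/
lemma norm_toLp_quadRe_sum_smul_rankOneProj_le {p : ℝ≥0∞} (hp : 1 ≤ p)
    (u w : OrthonormalBasis (Fin n) ℂ (EuclideanSpace ℂ (Fin n))) (ε : Fin n → ℝ) :
    ‖WithLp.toLp p fun k => quadRe (∑ i, ε i • rankOneProj (u i)) (w k)‖ ≤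
      ‖WithLp.toLp p ε‖ := by
  simp only [quadRe_sum_smul, quadRe_rankOneProj]
  refine norm_toLp_doublyStochastic_le hp (fun i k => ‖inner ℂ (u i) (w k)‖ ^ 2)
    (fun _ _ => by positivity) (fun i => ?_) (fun k => ?_) ε
  · rw [w.sum_sq_norm_inner_left, u.norm_eq_one, one_pow]
  · rw [u.sum_sq_norm_inner_right, w.norm_eq_one, one_pow]

/-- Pinching inequality for the spectral `p`-norm. -/
lemma norm_toLp_quadRe_le_specPNorm {p : ℝ≥0∞} (hp : 1 ≤ p) {H : Matrix (Fin n) (Fin n) ℂ}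
    (hH : H.IsHermitian) (w : OrthonormalBasis (Fin n) ℂ (EuclideanSpace ℂ (Fin n))) :
    ‖WithLp.toLp p fun k => quadRe H (w k)‖ ≤ specPNorm p H := by
  rw [specPNorm_eq_norm (one_pos.trans_le hp).ne' hH]
  have h := norm_toLp_quadRe_sum_smul_rankOneProj_le hp hH.eigenvectorBasis w hH.eigenvalues
  rwa [← hH.eq_sum_eigenvalues_smul_rankOneProj] at h

lemma specPNorm_sum_smul_rankOneProj_le {p : ℝ≥0∞} (hp : 1 ≤ p)
    (u : OrthonormalBasis (Fin n) ℂ (EuclideanSpace ℂ (Fin n))) (ε : Fin n → ℝ) :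
    specPNorm p (∑ i, ε i • rankOneProj (u i)) ≤ ‖WithLp.toLp p ε‖ := by
  have hX := isHermitian_sum_smul_rankOneProj u ε
  rw [specPNorm_eq_norm (one_pos.trans_le hp).ne' hX, funext hX.eigenvalues_eq_quadRe]
  exact norm_toLp_quadRe_sum_smul_rankOneProj_le hp u _ ε

lemma specPNorm_zero {p : ℝ≥0∞} (hp : 1 ≤ p) :
    specPNorm p (0 : Matrix (Fin n) (Fin n) ℂ) = 0 := by
  have : Fact (1 ≤ p) := ⟨hp⟩
  have h0 : (0 : Matrix (Fin n) (Fin n) ℂ).IsHermitian := Matrix.isHermitian_zero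
  rw [specPNorm_eq_norm (one_pos.trans_le hp).ne' h0, h0.eigenvalues_eq_zero_iff.2 rfl,
    WithLp.toLp_zero, norm_zero]

lemma specPNorm_nonneg (p : ℝ≥0∞) (A : Matrix (Fin n) (Fin n) ℂ) : 0 ≤ specPNorm p A := by
  unfold specPNorm
  split_ifs
  · exact Real.iSup_nonneg fun _ => abs_nonneg _
  · positivity
  · rfl

lemma specPNorm_pos {p : ℝ≥0∞} (hp : 1 ≤ p) {A : Matrix (Fin n) (Fin n) ℂ}
    (hA : A.IsHermitian) (hA0 : A ≠ 0) : 0 < specPNorm p A := by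
  have : Fact (1 ≤ p) := ⟨hp⟩
  rw [specPNorm_eq_norm (one_pos.trans_le hp).ne' hA, norm_pos_iff]
  intro h
  exact hA0 (hA.eigenvalues_eq_zero_iff.1 (congrArg WithLp.ofLp h))

lemma hermOpNorm_nonneg (r s : ℝ≥0∞)
    (T : Matrix (Fin n) (Fin n) ℂ →ₗ[ℝ] Matrix (Fin n) (Fin n) ℂ) : 0 ≤ hermOpNorm r s T :=
  Real.iSup_nonneg fun _ => div_nonneg (specPNorm_nonneg _ _) (specPNorm_nonneg _ _)

lemma Matrix.IsHermitian.quadRe_map_eq_sum_eigenvalues {A : Matrix (Fin n) (Fin n) ℂ}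
    (hA : A.IsHermitian) (T : Matrix (Fin n) (Fin n) ℂ →ₗ[ℝ] Matrix (Fin n) (Fin n) ℂ)
    (f : EuclideanSpace ℂ (Fin n)) :
    quadRe (T A) f =
      ∑ i, hA.eigenvalues i * quadRe (T (rankOneProj (hA.eigenvectorBasis i))) f := by
  conv_lhs => rw [hA.eq_sum_eigenvalues_smul_rankOneProj]
  simp only [map_sum, map_smul, quadRe_sum_smul]

lemma exists_abs_quadRe_map_rankOneProj_le
    (T : Matrix (Fin n) (Fin n) ℂ →ₗ[ℝ] Matrix (Fin n) (Fin n) ℂ) :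
    ∃ D : ℝ, ∀ u v : EuclideanSpace ℂ (Fin n), ‖u‖ = 1 → ‖v‖ = 1 →
      |quadRe (T (rankOneProj u)) v| ≤ D := by
  have hT : Continuous T := T.continuous_of_finiteDimensional
  have hcont : Continuous fun x : EuclideanSpace ℂ (Fin n) × EuclideanSpace ℂ (Fin n) =>
      quadRe (T (rankOneProj x.1)) x.2 := by
    unfold quadRe rankOneProj
    fun_prop
  obtain ⟨D, hD⟩ := ((isCompact_sphere (0 : EuclideanSpace ℂ (Fin n)) 1).prod
    (isCompact_sphere (0 : EuclideanSpace ℂ (Fin n)) 1)).exists_bound_of_continuousOn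
      hcont.continuousOn
  exact ⟨D, fun u v hu hv => hD (u, v) (by simp [hu, hv])⟩

lemma exists_specPNorm_map_le {r s : ℝ≥0∞} (hr : 1 ≤ r) (hs : 1 ≤ s)
    (T : Matrix (Fin n) (Fin n) ℂ →ₗ[ℝ] Matrix (Fin n) (Fin n) ℂ)
    (hT : ∀ A : Matrix (Fin n) (Fin n) ℂ, A.IsHermitian → (T A).IsHermitian) :
    ∃ C : ℝ, ∀ A : Matrix (Fin n) (Fin n) ℂ, A.IsHermitian →
      specPNorm s (T A) ≤ C * specPNorm r A := by
  have : Fact (1 ≤ r) := ⟨hr⟩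
  have : Fact (1 ≤ s) := ⟨hs⟩
  obtain ⟨D, hD⟩ := exists_abs_quadRe_map_rankOneProj_le T
  refine ⟨‖WithLp.toLp s fun _ : Fin n => n * D‖, fun A hA => ?_⟩
  have hTA := hT A hA
  rw [specPNorm_eq_norm (one_pos.trans_le hr).ne' hA,
    specPNorm_eq_norm (one_pos.trans_le hs).ne' hTA, mul_comm]
  set N := ‖WithLp.toLp r hA.eigenvalues‖
  have key : ‖WithLp.toLp s hTA.eigenvalues‖ ≤ ‖WithLp.toLp s (N • fun _ : Fin n => n * D)‖ := by
    refine norm_toLp_mono (one_pos.trans_le hs).ne' fun k => ?_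
    refine le_trans ?_ (le_abs_self _)
    rw [hTA.eigenvalues_eq_quadRe, hA.quadRe_map_eq_sum_eigenvalues T]
    calc _ ≤ ∑ i : Fin n, N * D := by
          refine (Finset.abs_sum_le_sum_abs _ _).trans (Finset.sum_le_sum fun i _ => ?_)
          rw [abs_mul]
          exact mul_le_mul (PiLp.norm_apply_le (WithLp.toLp r hA.eigenvalues) i)
            (hD _ _ (OrthonormalBasis.norm_eq_one _ _) (OrthonormalBasis.norm_eq_one _ _))
            (abs_nonneg _) (norm_nonneg _)
      _ = (N • fun _ : Fin n => (n : ℝ) * D) k := by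
          simp only [Finset.sum_const, Finset.card_univ, Fintype.card_fin, nsmul_eq_mul,
            Pi.smul_apply, smul_eq_mul]
          ring
  rwa [WithLp.toLp_smul, norm_smul, Real.norm_of_nonneg (norm_nonneg _)] at key

lemma specPNorm_map_le_hermOpNorm_mul {r s : ℝ≥0∞} (hr : 1 ≤ r) (hs : 1 ≤ s)
    (T : Matrix (Fin n) (Fin n) ℂ →ₗ[ℝ] Matrix (Fin n) (Fin n) ℂ)
    (hT : ∀ A : Matrix (Fin n) (Fin n) ℂ, A.IsHermitian → (T A).IsHermitian)
    {A : Matrix (Fin n) (Fin n) ℂ} (hA : A.IsHermitian) :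
    specPNorm s (T A) ≤ hermOpNorm r s T * specPNorm r A := by
  by_cases hA0 : A = 0
  · rw [hA0, map_zero, specPNorm_zero hr, specPNorm_zero hs, mul_zero]
  rw [← div_le_iff₀ (specPNorm_pos hr hA hA0)]
  obtain ⟨C, hC⟩ := exists_specPNorm_map_le hr hs T hT
  refine le_ciSup (f := fun A : {A : Matrix (Fin n) (Fin n) ℂ // A.IsHermitian ∧ A ≠ 0} =>
    specPNorm s (T A.1) / specPNorm r A.1) ⟨C, ?_⟩ ⟨A, hA, hA0⟩
  rintro _ ⟨B, rfl⟩
  exact (div_le_iff₀ (specPNorm_pos hr B.2.1 B.2.2)).2 (hC B.1 B.2.1)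

/-- The `ℓ^∞` operator norm of the matrix of `T` in a pair of orthonormal bases. -/
lemma sum_abs_quadRe_map_rankOneProj_le
    (T : Matrix (Fin n) (Fin n) ℂ →ₗ[ℝ] Matrix (Fin n) (Fin n) ℂ)
    (hT : ∀ A : Matrix (Fin n) (Fin n) ℂ, A.IsHermitian → (T A).IsHermitian)
    (u v : OrthonormalBasis (Fin n) ℂ (EuclideanSpace ℂ (Fin n))) (j : Fin n) :
    ∑ i, |quadRe (T (rankOneProj (u i))) (v j)| ≤ hermOpNorm ∞ ∞ T := by
  set ε : Fin n → ℝ := fun i => SignType.sign (quadRe (T (rankOneProj (u i))) (v j)) with hε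
  have hX := isHermitian_sum_smul_rankOneProj u ε
  have hε1 : ‖WithLp.toLp ∞ ε‖ ≤ 1 := by
    rw [PiLp.norm_eq_ciSup]
    refine Real.iSup_le (fun i => ?_) zero_le_one
    rcases SignType.trichotomy (SignType.sign (quadRe (T (rankOneProj (u i))) (v j)))
      with h | h | h <;> simp [hε, h]
  calc ∑ i, |quadRe (T (rankOneProj (u i))) (v j)|
      = quadRe (T (∑ i, ε i • rankOneProj (u i))) (v j) := by
        simp only [map_sum, map_smul, quadRe_sum_smul, hε, sign_mul_self]
    _ ≤ ‖WithLp.toLp ∞ fun k => quadRe (T (∑ i, ε i • rankOneProj (u i))) (v k)‖ :=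
        (le_abs_self _).trans (PiLp.norm_apply_le
          (WithLp.toLp ∞ fun k => quadRe (T (∑ i, ε i • rankOneProj (u i))) (v k)) j)
    _ ≤ specPNorm ∞ (T (∑ i, ε i • rankOneProj (u i))) :=
        norm_toLp_quadRe_le_specPNorm le_top (hT _ hX) v
    _ ≤ hermOpNorm ∞ ∞ T * specPNorm ∞ (∑ i, ε i • rankOneProj (u i)) :=
        specPNorm_map_le_hermOpNorm_mul le_top le_top T hT hX
    _ ≤ hermOpNorm ∞ ∞ T * 1 := mul_le_mul_of_nonneg_left
        ((specPNorm_sum_smul_rankOneProj_le le_top u ε).trans hε1) (hermOpNorm_nonneg _ _ _)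
    _ = hermOpNorm ∞ ∞ T := mul_one _

/-- The columns of the matrix of `T` in a pair of orthonormal bases. -/
lemma norm_toLp_quadRe_map_rankOneProj_le {t : ℝ≥0∞} (ht : 1 ≤ t)
    (T : Matrix (Fin n) (Fin n) ℂ →ₗ[ℝ] Matrix (Fin n) (Fin n) ℂ)
    (hT : ∀ A : Matrix (Fin n) (Fin n) ℂ, A.IsHermitian → (T A).IsHermitian)
    (u v : OrthonormalBasis (Fin n) ℂ (EuclideanSpace ℂ (Fin n))) (i : Fin n) :
    ‖WithLp.toLp t fun j => quadRe (T (rankOneProj (u i))) (v j)‖ ≤ hermOpNorm 1 t T := by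
  have hX := isHermitian_rankOneProj (u i)
  have h1 : specPNorm 1 (rankOneProj (u i)) ≤ 1 := by
    have h := specPNorm_sum_smul_rankOneProj_le le_rfl u (Pi.single i 1)
    simpa [Pi.single_apply, ite_smul] using h
  calc _ ≤ specPNorm t (T (rankOneProj (u i))) := norm_toLp_quadRe_le_specPNorm ht (hT _ hX) v
    _ ≤ hermOpNorm 1 t T * specPNorm 1 (rankOneProj (u i)) :=
        specPNorm_map_le_hermOpNorm_mul le_rfl ht T hT hX
    _ ≤ hermOpNorm 1 t T * 1 := mul_le_mul_of_nonneg_left h1 (hermOpNorm_nonneg _ _ _)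
    _ = hermOpNorm 1 t T := mul_one _

lemma norm_toLp_rpow_inv {r s : ℝ≥0∞} (hr : r ≠ 0) (hr' : r ≠ ∞) (hs : s ≠ 0)
    {g : Fin n → ℝ} (hg : ∀ j, 0 ≤ g j) :
    ‖WithLp.toLp s fun j => g j ^ r.toReal⁻¹‖ ≤ ‖WithLp.toLp (s / r) g‖ ^ r.toReal⁻¹ := by
  have hr0 := ENNReal.toReal_pos hr hr'
  by_cases hst : s = ∞
  · subst hst
    rw [PiLp.norm_eq_ciSup, ENNReal.top_div_of_ne_top hr']
    refine Real.iSup_le (fun j => ?_) (by positivity)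
    rw [Real.norm_of_nonneg (Real.rpow_nonneg (hg j) _)]
    refine Real.rpow_le_rpow (hg j) ?_ (by positivity)
    exact (le_abs_self _).trans (PiLp.norm_apply_le (WithLp.toLp ∞ g) j)
  · have hs0 := ENNReal.toReal_pos hs hst
    have hq : (s / r).toReal = s.toReal / r.toReal := ENNReal.toReal_div _ _
    rw [PiLp.norm_eq_sum hs0, PiLp.norm_eq_sum (by rw [hq]; positivity), hq,
      ← Real.rpow_mul (by positivity)]
    refine le_of_eq ?_
    congr 1
    · refine Finset.sum_congr rfl fun j _ => ?_
      rw [Real.norm_of_nonneg (Real.rpow_nonneg (hg j) _), Real.norm_of_nonneg (hg j),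
        ← Real.rpow_mul (hg j)]
      congr 1
      field_simp
    · field_simp

/-- Interpolation for a real matrix `K` between `ℓ^∞ → ℓ^∞` and `ℓ^1 → ℓ^{s/r}`. -/
lemma norm_toLp_sum_mul_le {r s : ℝ≥0∞} (hr : 1 ≤ r) (hrs : r < s) (K : Fin n → Fin n → ℝ)
    {M N : ℝ} (hM0 : 0 ≤ M) (hN0 : 0 ≤ N) (hM : ∀ j, ∑ i, |K i j| ≤ M)
    (hN : ∀ i, ‖WithLp.toLp (s / r) (K i)‖ ≤ N) (a : Fin n → ℝ) :
    ‖WithLp.toLp s fun j => ∑ i, a i * K i j‖ ≤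
      M ^ (1 - r.toReal⁻¹) * N ^ r.toReal⁻¹ * ‖WithLp.toLp r a‖ := by
  have hr0 : r ≠ 0 := (one_pos.trans_le hr).ne'
  have hrt : r ≠ ∞ := hrs.ne_top
  have hs0 : s ≠ 0 := (one_pos.trans_le (hr.trans hrs.le)).ne'
  have hr1 : 1 ≤ r.toReal := by
    rwa [← ENNReal.toReal_one, ENNReal.toReal_le_toReal ENNReal.one_ne_top hrt]
  have hrpos : 0 < r.toReal := by linarith
  have hexp : 0 ≤ 1 - r.toReal⁻¹ := sub_nonneg.2 (inv_le_one_of_one_le₀ hr1)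
  have ht : 1 ≤ s / r := by
    rw [ENNReal.le_div_iff_mul_le (Or.inl hr0) (Or.inl hrt), one_mul]
    exact hrs.le
  have : Fact (1 ≤ s) := ⟨hr.trans hrs.le⟩
  have : Fact (1 ≤ s / r) := ⟨ht⟩
  set g : Fin n → ℝ := fun j => ∑ i, |K i j| * |a i| ^ r.toReal with hg
  have hg0 : ∀ j, 0 ≤ g j := fun j => by positivity
  have hgN : ‖WithLp.toLp (s / r) g‖ ≤ N * ∑ i, |a i| ^ r.toReal := by
    have hsum : WithLp.toLp (s / r) g =
        ∑ i, (|a i| ^ r.toReal) • WithLp.toLp (s / r) fun j => |K i j| := by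
      ext j
      simp [hg, mul_comm]
    rw [hsum, Finset.mul_sum]
    refine (norm_sum_le _ _).trans (Finset.sum_le_sum fun i _ => ?_)
    rw [norm_smul, Real.norm_of_nonneg (by positivity), mul_comm]
    refine mul_le_mul_of_nonneg_right ((norm_toLp_mono ?_ fun j => ?_).trans (hN i))
      (by positivity)
    · exact (one_pos.trans_le ht).ne'
    · rw [abs_abs]
  have hpt : ∀ j, |∑ i, a i * K i j| ≤
      |(M ^ (1 - r.toReal⁻¹) • fun j => g j ^ r.toReal⁻¹) j| := fun j => by
    refine le_trans ?_ (le_abs_self _)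
    calc |∑ i, a i * K i j| ≤ ∑ i, |K i j| * |a i| := by
          refine (Finset.abs_sum_le_sum_abs _ _).trans (Finset.sum_le_sum fun i _ => ?_)
          rw [abs_mul, mul_comm]
      _ ≤ (∑ i, |K i j|) ^ (1 - r.toReal⁻¹) * g j ^ r.toReal⁻¹ :=
          Real.inner_le_weight_mul_Lp_of_nonneg _ hr1 _ _ (fun _ => abs_nonneg _)
            (fun _ => abs_nonneg _)
      _ ≤ M ^ (1 - r.toReal⁻¹) * g j ^ r.toReal⁻¹ := by
          gcongr
          exact hM j
  calc _ ≤ ‖WithLp.toLp s (M ^ (1 - r.toReal⁻¹) • fun j => g j ^ r.toReal⁻¹)‖ :=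
        norm_toLp_mono hs0 hpt
    _ = M ^ (1 - r.toReal⁻¹) * ‖WithLp.toLp s fun j => g j ^ r.toReal⁻¹‖ := by
        rw [WithLp.toLp_smul, norm_smul, Real.norm_of_nonneg (by positivity)]
    _ ≤ M ^ (1 - r.toReal⁻¹) * (N * ∑ i, |a i| ^ r.toReal) ^ r.toReal⁻¹ := by
        refine mul_le_mul_of_nonneg_left ((norm_toLp_rpow_inv hr0 hrt hs0 hg0).trans ?_)
          (by positivity)
        gcongr
    _ = M ^ (1 - r.toReal⁻¹) * N ^ r.toReal⁻¹ * ‖WithLp.toLp r a‖ := by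
        rw [PiLp.norm_eq_sum hrpos, Real.mul_rpow hN0 (by positivity), one_div, mul_assoc]
        rfl

/-- Interpolation with constant one. -/
lemma hermOpNorm_le_rpow_mul_rpow (r s : ℝ≥0∞) (hr : 1 ≤ r) (hrs : r < s)
    (T : Matrix (Fin n) (Fin n) ℂ →ₗ[ℝ] Matrix (Fin n) (Fin n) ℂ)
    (hT : ∀ A : Matrix (Fin n) (Fin n) ℂ, A.IsHermitian → (T A).IsHermitian) :
    hermOpNorm r s T ≤
      hermOpNorm ∞ ∞ T ^ (1 - r.toReal⁻¹) * hermOpNorm 1 (s / r) T ^ r.toReal⁻¹ := by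
  have h0 := hermOpNorm_nonneg ∞ ∞ T
  have h1 := hermOpNorm_nonneg 1 (s / r) T
  have hs : 1 ≤ s := hr.trans hrs.le
  have hr0 : r ≠ 0 := (one_pos.trans_le hr).ne'
  have ht : 1 ≤ s / r := by
    rw [ENNReal.le_div_iff_mul_le (Or.inl hr0) (Or.inl hrs.ne_top), one_mul]
    exact hrs.le
  refine Real.iSup_le (fun A => ?_) (by positivity)
  obtain ⟨A, hA, hA0⟩ := A
  have hTA := hT A hA
  rw [div_le_iff₀ (specPNorm_pos hr hA hA0), specPNorm_eq_norm hr0 hA,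
    specPNorm_eq_norm (one_pos.trans_le hs).ne' hTA]
  have heig : hTA.eigenvalues = fun j => ∑ i, hA.eigenvalues i *
      quadRe (T (rankOneProj (hA.eigenvectorBasis i))) (hTA.eigenvectorBasis j) := by
    ext j
    rw [hTA.eigenvalues_eq_quadRe, hA.quadRe_map_eq_sum_eigenvalues T]
  rw [heig]
  exact norm_toLp_sum_mul_le hr hrs _ h0 h1
    (sum_abs_quadRe_map_rankOneProj_le T hT hA.eigenvectorBasis hTA.eigenvectorBasis)
    (norm_toLp_quadRe_map_rankOneProj_le ht T hT hA.eigenvectorBasis hTA.eigenvectorBasis) _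

end

/-- Corollary 3.2, case `r < s`, in the algebra of Hermitian matrices:
`‖T‖_{r→s} ≤ 2√2 ‖T‖_{∞→∞}^{1-1/r} ‖T‖_{1→s/r}^{1/r}`. -/
theorem corollary_r_lt_s {n : ℕ} (r s : ℝ≥0∞) (hr : 1 ≤ r) (hrs : r < s)
    (T : Matrix (Fin n) (Fin n) ℂ →ₗ[ℝ] Matrix (Fin n) (Fin n) ℂ)
    (hT : ∀ A : Matrix (Fin n) (Fin n) ℂ, A.IsHermitian → (T A).IsHermitian) :
    hermOpNorm r s T ≤
      2 * Real.sqrt 2 * hermOpNorm ∞ ∞ T ^ (1 - (1 / r).toReal) *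
        hermOpNorm 1 (s / r) T ^ (1 / r).toReal := by
  have h0 := hermOpNorm_nonneg ∞ ∞ T
  have h1 := hermOpNorm_nonneg 1 (s / r) T
  have hc : (1 : ℝ) ≤ 2 * Real.sqrt 2 := by
    have := Real.one_le_sqrt.2 one_le_two
    linarith
  have hr' : (1 / r).toReal = r.toReal⁻¹ := by rw [one_div, ENNReal.toReal_inv]
  rw [hr', mul_assoc]
  exact (hermOpNorm_le_rpow_mul_rpow r s hr hrs T hT).trans
    (le_mul_of_one_le_left (by positivity) hc)
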